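/- Let 𝒜 be a family of d-element subsets of a finite set X that is both Gotzmann and dual-Gotzmann. Then there exists a linear order on X such that 𝒜 is a lex segment, i.e., an initial segment of the d-element subsets of X in the lex order induced by that linear order. -/

import Mathlib

/-- The upper shadow `∂⁺𝒜 = {A ∪ {x} : A ∈ 𝒜, x ∈ X \ A}` of a family of finite
sets, taken within the ground set `X`. -/
def upShadowIn {α : Type*} [DecidableEq α] (X : Finset α) (𝒜 : Set (Finset α)) :
    Set (Finset α) :=
  {B | ∃ A ∈ 𝒜, ∃ x ∈ X, x ∉ A ∧ B = insert x A}

/-- A Gotzmann family of `d`-element subsets of the ground set `X`: its upper shadow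
(in `X`) is no larger than that of any other family of `d`-element subsets of `X` of
the same cardinality. -/
def IsGotzmannFamily {α : Type*} [DecidableEq α] (X : Finset α) (d : ℕ)
    (𝒜 : Set (Finset α)) : Prop :=
  (∀ A ∈ 𝒜, A ⊆ X ∧ A.card = d) ∧
    ∀ ℬ : Set (Finset α), (∀ B ∈ ℬ, B ⊆ X ∧ B.card = d) → ℬ.ncard = 𝒜.ncard →
      (upShadowIn X 𝒜).ncard ≤ (upShadowIn X ℬ).ncard

/-- First part `𝒜₀ = {A ∈ 𝒜 : i ∉ A}` of the `i`-decomposition of `𝒜`. -/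
def decompZero {α : Type*} (i : α) (𝒜 : Set (Finset α)) : Set (Finset α) :=
  {A ∈ 𝒜 | i ∉ A}

/-- Second part `𝒜₁ = {A \ {i} : A ∈ 𝒜, i ∈ A}` of the `i`-decomposition of `𝒜`. -/
def decompOne {α : Type*} [DecidableEq α] (i : α) (𝒜 : Set (Finset α)) : Set (Finset α) :=
  {B | ∃ A ∈ 𝒜, i ∈ A ∧ B = A.erase i}

/-- `A` precedes `B` in the lex order on finite sets induced by the strict order `r`:
the `r`-least element of the symmetric difference `A Δ B` lies in `A`. -/
def lexLT {α : Type*} (r : α → α → Prop) (A B : Finset α) : Prop :=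
  ∃ x ∈ A, x ∉ B ∧ ∀ y, r y x → (y ∈ A ↔ y ∈ B)

/-- `r` is a strict linear order on the elements of `Y`. -/
def IsLinearOrderOn {α : Type*} (r : α → α → Prop) (Y : Finset α) : Prop :=
  (∀ a ∈ Y, ¬ r a a) ∧
    (∀ a ∈ Y, ∀ b ∈ Y, ∀ c ∈ Y, r a b → r b c → r a c) ∧
    (∀ a ∈ Y, ∀ b ∈ Y, a ≠ b → r a b ∨ r b a)

/-- A lex segment: a family of `e`-element subsets of `Y` that is an initial segment
of the lex order (induced by the strict order `r`) on `e`-element subsets of `Y`. -/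
def IsLexSegmentFamily {α : Type*} (r : α → α → Prop) (Y : Finset α) (e : ℕ)
    (L : Set (Finset α)) : Prop :=
  (∀ B ∈ L, B ⊆ Y ∧ B.card = e) ∧
    ∀ B ∈ L, ∀ A : Finset α, A ⊆ Y → A.card = e → lexLT r A B → A ∈ L

/-- The Alexander dual `𝒜^∨ = {X \ A : A ⊆ X, |A| = d, A ∉ 𝒜}` of a family `𝒜` of
`d`-element subsets of `X`. -/
def alexDual {α : Type*} [DecidableEq α] (X : Finset α) (d : ℕ) (𝒜 : Set (Finset α)) :
    Set (Finset α) :=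
  {B | ∃ A : Finset α, A ⊆ X ∧ A.card = d ∧ A ∉ 𝒜 ∧ B = X \ A}

/-- A family of `d`-element subsets of `X` is dual-Gotzmann if its Alexander dual is
Gotzmann in `X`. -/
def IsDualGotzmann {α : Type*} [DecidableEq α] (X : Finset α) (d : ℕ)
    (𝒜 : Set (Finset α)) : Prop :=
  IsGotzmannFamily X (X.card - d) (alexDual X d 𝒜)


namespace GotzmannFamily

open Finset

variable {α : Type*} [DecidableEq α]

/-- The upper shadow of a finite family within the ground set `X`. -/
def upIn (X : Finset α) (𝒜 : Finset (Finset α)) : Finset (Finset α) :=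
  𝒜.biUnion fun A => (X \ A).image fun x => insert x A

theorem mem_upIn {X B : Finset α} {𝒜 : Finset (Finset α)} :
    B ∈ upIn X 𝒜 ↔ ∃ A ∈ 𝒜, ∃ x ∈ X, x ∉ A ∧ insert x A = B := by
  simp [upIn, and_assoc]

theorem mem_upIn_iff_erase {X B : Finset α} {𝒜 : Finset (Finset α)} :
    B ∈ upIn X 𝒜 ↔ ∃ x ∈ B, x ∈ X ∧ B.erase x ∈ 𝒜 := by
  rw [mem_upIn]
  constructor
  · rintro ⟨A, hA, x, hx, hxA, rfl⟩
    exact ⟨x, mem_insert_self _ _, hx, by rwa [erase_insert hxA]⟩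
  · rintro ⟨x, hxB, hx, h⟩
    exact ⟨_, h, x, hx, notMem_erase _ _, insert_erase hxB⟩

theorem upIn_empty (X : Finset α) : upIn X ∅ = ∅ := by simp [upIn]

theorem upIn_mono {X : Finset α} {𝒜 ℬ : Finset (Finset α)} (h : 𝒜 ⊆ ℬ) :
    upIn X 𝒜 ⊆ upIn X ℬ := biUnion_subset_biUnion_of_subset_left _ h

theorem upIn_union (X : Finset α) (𝒜 ℬ : Finset (Finset α)) :
    upIn X (𝒜 ∪ ℬ) = upIn X 𝒜 ∪ upIn X ℬ := by
  ext B; simp only [mem_union, mem_upIn_iff_erase]; aesop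

theorem upIn_subset {X : Finset α} {d : ℕ} {𝒜 : Finset (Finset α)}
    (h : 𝒜 ⊆ powersetCard d X) : upIn X 𝒜 ⊆ powersetCard (d + 1) X := by
  intro B hB
  obtain ⟨A, hA, x, hx, hxA, rfl⟩ := mem_upIn.1 hB
  obtain ⟨h1, h2⟩ := mem_powersetCard.1 (h hA)
  exact mem_powersetCard.2 ⟨insert_subset hx h1, by rw [card_insert_of_notMem hxA, h2]⟩

/-- `𝒜` consists of `d`-subsets of `X` and has the least upper shadow for its size. -/
def IsGotz (X : Finset α) (d : ℕ) (𝒜 : Finset (Finset α)) : Prop :=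
  𝒜 ⊆ powersetCard d X ∧
    ∀ ℬ ⊆ powersetCard d X, #ℬ = #𝒜 → #(upIn X 𝒜) ≤ #(upIn X ℬ)

/-- The Alexander dual of a finite family. -/
def dual (X : Finset α) (d : ℕ) (𝒜 : Finset (Finset α)) : Finset (Finset α) :=
  X.powerset.filter fun B => #(X \ B) = d ∧ X \ B ∉ 𝒜

theorem mem_dual {X B : Finset α} {d : ℕ} {𝒜 : Finset (Finset α)} :
    B ∈ dual X d 𝒜 ↔ B ⊆ X ∧ #(X \ B) = d ∧ X \ B ∉ 𝒜 := by
  simp [dual]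

theorem sdiff_mem_dual {X A : Finset α} {d : ℕ} {𝒜 : Finset (Finset α)}
    (hA : A ⊆ X) (hd : #A = d) : X \ A ∈ dual X d 𝒜 ↔ A ∉ 𝒜 := by
  rw [mem_dual, Finset.sdiff_sdiff_eq_self hA]
  exact ⟨fun h => h.2.2, fun h => ⟨sdiff_subset, hd, h⟩⟩

theorem card_dual_add {X : Finset α} {d : ℕ} {𝒜 : Finset (Finset α)}
    (h : 𝒜 ⊆ powersetCard d X) : #(dual X d 𝒜) + #𝒜 = (#X).choose d := by
  have : #(dual X d 𝒜) = #(powersetCard d X \ 𝒜) := by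
    apply card_bij' (fun B _ => X \ B) (fun B _ => X \ B)
    · intro B hB
      obtain ⟨h1, h2, h3⟩ := mem_dual.1 hB
      exact mem_sdiff.2 ⟨mem_powersetCard.2 ⟨sdiff_subset, h2⟩, h3⟩
    · intro A hA
      obtain ⟨h1, h2⟩ := mem_sdiff.1 hA
      obtain ⟨h3, h4⟩ := mem_powersetCard.1 h1
      exact (sdiff_mem_dual h3 h4).2 h2
    · intro B hB
      exact Finset.sdiff_sdiff_eq_self (mem_dual.1 hB).1
    · intro B hB
      exact Finset.sdiff_sdiff_eq_self (mem_powersetCard.1 (mem_sdiff.1 hB).1).1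
  rw [this, card_sdiff_add_card_eq_card h, card_powersetCard]

section Sections

variable {X : Finset α} {i : α}

theorem nonMember_upIn (𝒜 : Finset (Finset α)) :
    nonMemberSubfamily i (upIn X 𝒜) = upIn (X.erase i) (nonMemberSubfamily i 𝒜) := by
  ext B
  simp only [mem_nonMemberSubfamily, mem_upIn_iff_erase, mem_erase]
  constructor
  · rintro ⟨⟨x, hx, hX, h⟩, hi⟩
    exact ⟨x, hx, ⟨fun e => hi (e ▸ hx), hX⟩, h, fun h => hi h.2⟩
  · rintro ⟨x, hx, ⟨hne, hX⟩, h, hi⟩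
    exact ⟨⟨x, hx, hX, h⟩, fun hB => hi ⟨hne.symm, hB⟩⟩

theorem member_upIn (hi : i ∈ X) (𝒜 : Finset (Finset α)) :
    memberSubfamily i (upIn X 𝒜) =
      nonMemberSubfamily i 𝒜 ∪ upIn (X.erase i) (memberSubfamily i 𝒜) := by
  ext B
  simp only [mem_memberSubfamily, mem_union, mem_nonMemberSubfamily, mem_upIn_iff_erase,
    mem_erase, mem_insert]
  constructor
  · rintro ⟨⟨x, hx, hX, h⟩, hB⟩
    by_cases e : x = i
    · subst e
      rw [erase_insert hB] at h
      exact Or.inl ⟨h, hB⟩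
    · rw [erase_insert_of_ne (Ne.symm e)] at h
      exact Or.inr ⟨x, hx.resolve_left e, ⟨e, hX⟩, h, fun h => hB h.2⟩
  · rintro (⟨h, hB⟩ | ⟨x, hx, ⟨hne, hX⟩, h, hB⟩)
    · exact ⟨⟨i, Or.inl rfl, hi, by rwa [erase_insert hB]⟩, hB⟩
    · refine ⟨⟨x, Or.inr hx, hX, by rwa [erase_insert_of_ne hne.symm]⟩, fun h => hB ⟨hne.symm, h⟩⟩

theorem card_upIn (hi : i ∈ X) (𝒜 : Finset (Finset α)) :
    #(upIn X 𝒜) = #(nonMemberSubfamily i 𝒜 ∪ upIn (X.erase i) (memberSubfamily i 𝒜)) +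
      #(upIn (X.erase i) (nonMemberSubfamily i 𝒜)) := by
  rw [← card_memberSubfamily_add_card_nonMemberSubfamily i, member_upIn hi, nonMember_upIn]

theorem nonMember_subset {d : ℕ} {𝒜 : Finset (Finset α)} (h : 𝒜 ⊆ powersetCard d X) :
    nonMemberSubfamily i 𝒜 ⊆ powersetCard d (X.erase i) := by
  intro B hB
  obtain ⟨h1, h2⟩ := mem_nonMemberSubfamily.1 hB
  obtain ⟨h3, h4⟩ := mem_powersetCard.1 (h h1)
  exact mem_powersetCard.2 ⟨subset_erase.2 ⟨h3, h2⟩, h4⟩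

theorem member_subset {d : ℕ} {𝒜 : Finset (Finset α)} (h : 𝒜 ⊆ powersetCard (d + 1) X) :
    memberSubfamily i 𝒜 ⊆ powersetCard d (X.erase i) := by
  intro B hB
  obtain ⟨h1, h2⟩ := mem_memberSubfamily.1 hB
  obtain ⟨h3, h4⟩ := mem_powersetCard.1 (h h1)
  rw [card_insert_of_notMem h2] at h4
  exact mem_powersetCard.2 ⟨subset_erase.2 ⟨(subset_insert _ _).trans h3, h2⟩, by omega⟩

theorem nonMember_dual (hi : i ∈ X) (d : ℕ) (𝒜 : Finset (Finset α)) :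
    nonMemberSubfamily i (dual X (d + 1) 𝒜) = dual (X.erase i) d (memberSubfamily i 𝒜) := by
  ext B
  simp only [mem_nonMemberSubfamily, mem_dual, mem_memberSubfamily, subset_erase]
  by_cases hB : i ∈ B
  · simp [hB]
  · have h1 : X \ B = insert i (X.erase i \ B) := by
      ext x; by_cases hx : x = i <;> simp_all
    have h2 : i ∉ X.erase i \ B := by simp
    rw [h1, card_insert_of_notMem h2]
    simp [hB]

theorem member_dual (hi : i ∈ X) (d : ℕ) (𝒜 : Finset (Finset α)) :
    memberSubfamily i (dual X d 𝒜) = dual (X.erase i) d (nonMemberSubfamily i 𝒜) := by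
  ext B
  simp only [mem_nonMemberSubfamily, mem_dual, mem_memberSubfamily, subset_erase]
  have h1 : X \ insert i B = X.erase i \ B := by
    ext x; by_cases hx : x = i <;> simp_all
  rw [h1, insert_subset_iff]
  simp only [hi, true_and, mem_sdiff, mem_erase]
  tauto

/-- The family with prescribed sections at `i`. -/
def glue (i : α) (N M : Finset (Finset α)) : Finset (Finset α) := N ∪ M.image (insert i)

variable {d : ℕ} {N M : Finset (Finset α)}

theorem glue_subset (hi : i ∈ X) (hN : N ⊆ powersetCard (d + 1) (X.erase i))
    (hM : M ⊆ powersetCard d (X.erase i)) : glue i N M ⊆ powersetCard (d + 1) X := by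
  intro B hB
  rw [glue, mem_union, mem_image] at hB
  rw [mem_powersetCard]
  rcases hB with hB | ⟨A, hA, rfl⟩
  · obtain ⟨h1, h2⟩ := mem_powersetCard.1 (hN hB)
    exact ⟨h1.trans (erase_subset _ _), h2⟩
  · obtain ⟨h1, h2⟩ := mem_powersetCard.1 (hM hA)
    obtain ⟨h3, h4⟩ := subset_erase.1 h1
    exact ⟨insert_subset hi h3, by rw [card_insert_of_notMem h4, h2]⟩

theorem nonMember_glue (hN : N ⊆ powersetCard d (X.erase i)) :
    nonMemberSubfamily i (glue i N M) = N := by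
  rw [glue, nonMemberSubfamily_union, nonMemberSubfamily_image_insert, union_empty]
  ext B
  rw [mem_nonMemberSubfamily]
  exact ⟨fun h => h.1, fun h => ⟨h, (subset_erase.1 (mem_powersetCard.1 (hN h)).1).2⟩⟩

theorem member_glue {e : ℕ} (hN : N ⊆ powersetCard d (X.erase i))
    (hM : M ⊆ powersetCard e (X.erase i)) :
    memberSubfamily i (glue i N M) = M := by
  rw [glue, memberSubfamily_union, memberSubfamily_image_insert
    (fun s hs => (subset_erase.1 (mem_powersetCard.1 (hM hs)).1).2)]
  convert empty_union M
  ext B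
  simp only [mem_memberSubfamily, notMem_empty, iff_false, not_and, not_not]
  intro h
  have := (subset_erase.1 (mem_powersetCard.1 (hN h)).1).2
  simp at this

theorem card_glue {e : ℕ} (hN : N ⊆ powersetCard d (X.erase i))
    (hM : M ⊆ powersetCard e (X.erase i)) : #(glue i N M) = #M + #N := by
  rw [← card_memberSubfamily_add_card_nonMemberSubfamily i, member_glue hN hM, nonMember_glue hN]

theorem card_upIn_glue {e : ℕ} (hi : i ∈ X) (hN : N ⊆ powersetCard d (X.erase i))
    (hM : M ⊆ powersetCard e (X.erase i)) :
    #(upIn X (glue i N M)) = #(N ∪ upIn (X.erase i) M) + #(upIn (X.erase i) N) := by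
  rw [card_upIn hi, member_glue hN hM, nonMember_glue hN]

end Sections

section KruskalKatona

open Colex
open scoped FinsetFamily

theorem exists_isInitSeg {n : ℕ} (r s : ℕ) (hs : s ≤ n.choose r) :
    ∃ 𝒞 : Finset (Finset (Fin n)), IsInitSeg 𝒞 r ∧ #𝒞 = s := by
  induction s with
  | zero => exact ⟨∅, isInitSeg_empty, rfl⟩
  | succ s ih =>
    obtain ⟨𝒞, h𝒞, hc⟩ := ih (by omega)
    have hne : (powersetCard r (univ : Finset (Fin n)) \ 𝒞).Nonempty := by
      rw [← card_pos]
      have := le_card_sdiff 𝒞 (powersetCard r (univ : Finset (Fin n)))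
      rw [card_powersetCard, card_univ, Fintype.card_fin] at this
      omega
    obtain ⟨A, hA, hmin⟩ := exists_min_image _ (fun A => toColex A) hne
    simp only [mem_sdiff, mem_powersetCard_univ] at hA hmin
    refine ⟨insert A 𝒞, ⟨?_, ?_⟩, by rw [card_insert_of_notMem hA.2, hc]⟩
    · intro B hB
      rcases mem_insert.1 (mem_coe.1 hB) with rfl | hB
      · exact hA.1
      · exact h𝒞.1 hB
    · rintro B C hB ⟨hlt, hcard⟩
      rcases mem_insert.1 hB with rfl | hB
      · by_contra hC
        exact absurd (hmin C ⟨hcard, fun h => hC (mem_insert_of_mem h)⟩) (not_le.2 hlt)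
      · exact mem_insert_of_mem (h𝒞.2 hB ⟨hlt, hcard⟩)

theorem upIn_image_compl_map {n : ℕ} (g : Fin n ↪ α) (𝒞 : Finset (Finset (Fin n))) :
    upIn (univ.map g) (𝒞.image fun S => Sᶜ.map g) = (∂ 𝒞).image fun S => Sᶜ.map g := by
  ext B
  simp only [mem_upIn, mem_image, mem_shadow_iff, mem_map, mem_univ, true_and]
  constructor
  · rintro ⟨_, ⟨S, hS, rfl⟩, _, ⟨a, rfl⟩, ha, rfl⟩
    refine ⟨_, ⟨S, hS, a, by simpa using ha, rfl⟩, ?_⟩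
    rw [compl_erase, map_insert]
  · rintro ⟨_, ⟨S, hS, a, ha, rfl⟩, rfl⟩
    exact ⟨_, ⟨S, hS, rfl⟩, g a, ⟨a, rfl⟩, by simpa using ha, by rw [compl_erase, map_insert]⟩

theorem compl_map_injective {β : Type*} {n : ℕ} (g : Fin n ↪ β) :
    Function.Injective fun S : Finset (Fin n) => Sᶜ.map g :=
  fun _ _ h => compl_injective (map_injective g h)

theorem image_compl_map_subset {n d r : ℕ} (hr : d + r = n) (g : Fin n ↪ α)
    {𝒞 : Finset (Finset (Fin n))} (h : (𝒞 : Set (Finset (Fin n))).Sized r) :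
    (𝒞.image fun S => Sᶜ.map g) ⊆ powersetCard d (univ.map g) := by
  intro B hB
  obtain ⟨S, hS, rfl⟩ := mem_image.1 hB
  have := h hS
  rw [mem_powersetCard, card_map, card_compl, Fintype.card_fin, this]
  exact ⟨map_subset_map.2 (subset_univ _), by omega⟩

theorem exists_eq_image_compl_map {n d r : ℕ} (hr : d + r = n) (g : Fin n ↪ α)
    {ℬ : Finset (Finset α)} (h : ℬ ⊆ powersetCard d (univ.map g)) :
    ∃ 𝒞 : Finset (Finset (Fin n)), (𝒞 : Set (Finset (Fin n))).Sized r ∧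
      ℬ = 𝒞.image fun S => Sᶜ.map g := by
  refine ⟨univ.filter fun S => Sᶜ.map g ∈ ℬ, ?_, ?_⟩
  · intro S hS
    have hS := (mem_filter.1 (mem_coe.1 hS)).2
    have := (mem_powersetCard.1 (h hS)).2
    rw [card_map, card_compl, Fintype.card_fin] at this
    have := card_le_univ S
    rw [Fintype.card_fin] at this
    omega
  · ext B
    simp only [mem_image, mem_filter, mem_univ, true_and]
    constructor
    · intro hB
      obtain ⟨T, -, rfl⟩ := subset_map_iff.1 (mem_powersetCard.1 (h hB)).1
      exact ⟨Tᶜ, by rwa [compl_compl], by rw [compl_compl]⟩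
    · rintro ⟨S, hS, rfl⟩
      exact hS

theorem isGotz_image_compl_map {n d r : ℕ} (hr : d + r = n) (g : Fin n ↪ α)
    {𝒞 : Finset (Finset (Fin n))} (h : IsInitSeg 𝒞 r) :
    IsGotz (univ.map g) d (𝒞.image fun S => Sᶜ.map g) := by
  refine ⟨image_compl_map_subset hr g h.1, fun ℬ hℬ hc => ?_⟩
  obtain ⟨𝒟, hD, rfl⟩ := exists_eq_image_compl_map hr g hℬ
  rw [card_image_of_injective _ (compl_map_injective g),
    card_image_of_injective _ (compl_map_injective g)] at hc
  rw [upIn_image_compl_map, upIn_image_compl_map,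
    card_image_of_injective _ (compl_map_injective g),
    card_image_of_injective _ (compl_map_injective g)]
  exact kruskal_katona hD hc.ge h

/-- Families with least upper shadow of any prescribed sizes can be chosen nested. -/
theorem exists_nested_isGotz (Y : Finset α) {d s t : ℕ} (hd : d + 1 ≤ #Y)
    (hs : s ≤ (#Y).choose (d + 1)) (ht : t ≤ (#Y).choose d) :
    ∃ N M : Finset (Finset α), IsGotz Y (d + 1) N ∧ IsGotz Y d M ∧ #N = s ∧ #M = t ∧
      (N ⊆ upIn Y M ∨ upIn Y M ⊆ N) := by
  obtain ⟨n, g, rfl⟩ : ∃ (n : ℕ) (g : Fin n ↪ α), Y = univ.map g :=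
    ⟨#Y, Y.equivFin.symm.toEmbedding.trans (Function.Embedding.subtype _), by
      rw [← map_map, map_univ_equiv, ← attach_eq_univ, attach_map_val]⟩
  rw [card_map, card_univ, Fintype.card_fin] at hd hs ht
  obtain ⟨r, rfl⟩ := Nat.exists_eq_add_of_le hd
  obtain ⟨𝒞, hC, rfl⟩ := exists_isInitSeg (n := d + 1 + r) r s
    (by rwa [← Nat.choose_symm_add] )
  obtain ⟨𝒟, hD, rfl⟩ := exists_isInitSeg (n := d + 1 + r) (r + 1) t
    (by
      rwa [Nat.choose_symm_of_eq_add (show d + 1 + r = (r + 1) + d by omega)])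
  refine ⟨_, _, isGotz_image_compl_map rfl g hC, isGotz_image_compl_map (by omega) g hD,
    card_image_of_injective _ (compl_map_injective g),
    card_image_of_injective _ (compl_map_injective g), ?_⟩
  rw [upIn_image_compl_map]
  exact (hC.total hD.shadow).imp image_subset_image image_subset_image

end KruskalKatona

theorem IsGotz.of_card_le {X : Finset α} {d : ℕ} {𝒜 ℬ : Finset (Finset α)} (h : IsGotz X d 𝒜)
    (hB : ℬ ⊆ powersetCard d X) (hc : #ℬ = #𝒜) (hle : #(upIn X ℬ) ≤ #(upIn X 𝒜)) :
    IsGotz X d ℬ :=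
  ⟨hB, fun 𝒞 hC hcC => hle.trans (h.2 𝒞 hC (hcC.trans hc))⟩

/-- Both sections of a Gotzmann family inherit extremality, the second one unless its upper
shadow lies in the first. -/
theorem IsGotz.sections {X : Finset α} {i : α} {d : ℕ} {𝒜 : Finset (Finset α)}
    (h : IsGotz X (d + 1) 𝒜) (hi : i ∈ X) (hd : d + 2 ≤ #X) :
    IsGotz (X.erase i) (d + 1) (nonMemberSubfamily i 𝒜) ∧
      (¬ upIn (X.erase i) (memberSubfamily i 𝒜) ⊆ nonMemberSubfamily i 𝒜 →
        IsGotz (X.erase i) d (memberSubfamily i 𝒜) ∧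
          nonMemberSubfamily i 𝒜 ⊆ upIn (X.erase i) (memberSubfamily i 𝒜)) := by
  have hN := nonMember_subset (i := i) h.1
  have hM := member_subset (i := i) h.1
  have hcY : #(X.erase i) + 1 = #X := card_erase_add_one hi
  obtain ⟨N, M, gN, gM, cN, cM, hnest⟩ := exists_nested_isGotz (X.erase i) (d := d)
    (s := #(nonMemberSubfamily i 𝒜)) (t := #(memberSubfamily i 𝒜)) (by omega)
    (by simpa using card_le_card hN) (by simpa using card_le_card hM)
  have key := h.2 _ (glue_subset hi gN.1 gM.1) (by
    rw [card_glue gN.1 gM.1, cN, cM, card_memberSubfamily_add_card_nonMemberSubfamily])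
  rw [card_upIn_glue hi gN.1 gM.1, card_upIn hi] at key
  set N' := nonMemberSubfamily i 𝒜
  set M' := memberSubfamily i 𝒜
  have h1 := gN.2 N' hN cN.symm
  have h2 := gM.2 M' hM cM.symm
  have h3 : #N' ≤ #(N' ∪ upIn (X.erase i) M') := card_le_card subset_union_left
  have h4 : #(upIn (X.erase i) M') ≤ #(N' ∪ upIn (X.erase i) M') :=
    card_le_card subset_union_right
  have h5 : #(N ∪ upIn (X.erase i) M) = #N ∨
      #(N ∪ upIn (X.erase i) M) = #(upIn (X.erase i) M) := by
    rcases hnest with hn | hn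
    · exact Or.inr (by rw [union_eq_right.2 hn])
    · exact Or.inl (by rw [union_eq_left.2 hn])
  refine ⟨gN.of_card_le hN cN.symm (by omega), fun hbad => ?_⟩
  have h6 : #N' < #(N' ∪ upIn (X.erase i) M') := by
    apply card_lt_card
    refine ⟨subset_union_left, fun hs => hbad (subset_union_right.trans hs)⟩
  refine ⟨gM.of_card_le hM cM.symm (by omega), ?_⟩
  have h7 : upIn (X.erase i) M' = N' ∪ upIn (X.erase i) M' :=
    eq_of_subset_of_card_le subset_union_right (by omega)
  rw [h7]
  exact subset_union_left

section Swap

variable {Y : Finset α} {a b : α}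

/-- Exchange the roles of `a` and `b` in a set. -/
def swapSet (a b : α) (A : Finset α) : Finset α := A.image (Equiv.swap a b)

theorem mem_swapSet {x : α} {A : Finset α} : x ∈ swapSet a b A ↔ Equiv.swap a b x ∈ A := by
  rw [swapSet, mem_image]
  exact ⟨by rintro ⟨y, hy, rfl⟩; simpa, fun h => ⟨_, h, by simp⟩⟩

theorem swapSet_swapSet (A : Finset α) : swapSet a b (swapSet a b A) = A := by
  ext x; simp [mem_swapSet]

theorem swapSet_comm (A : Finset α) : swapSet a b A = swapSet b a A := by
  rw [swapSet, swapSet, Equiv.swap_comm]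

theorem swapSet_injective (a b : α) : Function.Injective (swapSet a b) :=
  Function.LeftInverse.injective (g := swapSet a b) swapSet_swapSet

theorem card_swapSet (A : Finset α) : #(swapSet a b A) = #A :=
  card_image_of_injective _ (Equiv.injective _)

theorem swapSet_insert (x : α) (A : Finset α) :
    swapSet a b (insert x A) = insert (Equiv.swap a b x) (swapSet a b A) := image_insert _ _ _

theorem swapSet_sdiff (A B : Finset α) :
    swapSet a b (A \ B) = swapSet a b A \ swapSet a b B := by
  ext x; simp [mem_swapSet]

theorem swapSet_of_iff {A : Finset α} (h : a ∈ A ↔ b ∈ A) : swapSet a b A = A := by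
  ext x
  rw [mem_swapSet, Equiv.swap_apply_def]
  split_ifs <;> simp_all

theorem swapSet_of_mem {A : Finset α} (ha : a ∈ A) (hb : b ∉ A) :
    swapSet a b A = insert b (A.erase a) := by
  ext x
  rw [mem_swapSet, Equiv.swap_apply_def, mem_insert, mem_erase]
  grind

theorem swapSet_subset {A : Finset α} (ha : a ∈ Y) (hb : b ∈ Y) (hA : A ⊆ Y) :
    swapSet a b A ⊆ Y := by
  intro x hx
  rw [mem_swapSet, Equiv.swap_apply_def] at hx
  split_ifs at hx with h1 h2
  · exact h1 ▸ ha
  · exact h2 ▸ hb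
  · exact hA hx

/-- Exchange the roles of `a` and `b` in a family. -/
def swapFam (a b : α) (𝒜 : Finset (Finset α)) : Finset (Finset α) := 𝒜.image (swapSet a b)

theorem mem_swapFam {B : Finset α} {𝒜 : Finset (Finset α)} :
    B ∈ swapFam a b 𝒜 ↔ swapSet a b B ∈ 𝒜 := by
  rw [swapFam, mem_image]
  exact ⟨by rintro ⟨y, hy, rfl⟩; rwa [swapSet_swapSet], fun h => ⟨_, h, swapSet_swapSet _⟩⟩

theorem card_swapFam (𝒜 : Finset (Finset α)) : #(swapFam a b 𝒜) = #𝒜 :=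
  card_image_of_injective _ (swapSet_injective a b)

theorem swapFam_subset {d : ℕ} {𝒜 : Finset (Finset α)} (ha : a ∈ Y) (hb : b ∈ Y)
    (h : 𝒜 ⊆ powersetCard d Y) : swapFam a b 𝒜 ⊆ powersetCard d Y := by
  intro B hB
  obtain ⟨h1, h2⟩ := mem_powersetCard.1 (h (mem_swapFam.1 hB))
  rw [card_swapSet] at h2
  exact mem_powersetCard.2 ⟨swapSet_swapSet (a := a) (b := b) B ▸ swapSet_subset ha hb h1, h2⟩

theorem upIn_swapFam (ha : a ∈ Y) (hb : b ∈ Y) (𝒜 : Finset (Finset α)) :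
    upIn Y (swapFam a b 𝒜) = swapFam a b (upIn Y 𝒜) := by
  have hY : ∀ x, Equiv.swap a b x ∈ Y ↔ x ∈ Y := fun x => by
    rw [Equiv.swap_apply_def]; split_ifs <;> simp_all
  ext B
  rw [mem_swapFam, mem_upIn, mem_upIn]
  constructor
  · rintro ⟨A, hA, x, hx, hxA, rfl⟩
    refine ⟨_, mem_swapFam.1 hA, Equiv.swap a b x, (hY x).2 hx, ?_, (swapSet_insert _ _).symm⟩
    simpa [mem_swapSet] using hxA
  · rintro ⟨A, hA, x, hx, hxA, h⟩
    refine ⟨swapSet a b A, by rwa [mem_swapFam, swapSet_swapSet], Equiv.swap a b x, (hY x).2 hx,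
      by simpa [mem_swapSet] using hxA, ?_⟩
    rw [← swapSet_insert, h, swapSet_swapSet]

theorem dual_swapFam (ha : a ∈ Y) (hb : b ∈ Y) (d : ℕ) (𝒜 : Finset (Finset α)) :
    dual Y d (swapFam a b 𝒜) = swapFam a b (dual Y d 𝒜) := by
  have hY : swapSet a b Y = Y := swapSet_of_iff (by simp [ha, hb])
  ext B
  rw [mem_swapFam, mem_dual, mem_dual, mem_swapFam, swapSet_sdiff, hY]
  have h1 : Y \ swapSet a b B = swapSet a b (Y \ B) := by rw [swapSet_sdiff, hY]
  rw [h1, card_swapSet]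
  have h2 : swapSet a b B ⊆ Y ↔ B ⊆ Y :=
    ⟨fun h => swapSet_swapSet (a := a) (b := b) B ▸ swapSet_subset ha hb h,
      swapSet_subset ha hb⟩
  rw [h2]

/-- Any two sets of the same size are linked by exchanges. -/
theorem exchange_connected {e : ℕ} (p : Finset α → Prop)
    (hp : ∀ B ⊆ Y, #B = e → p B → ∀ a ∈ B, ∀ b ∈ Y, b ∉ B → p (swapSet a b B))
    {A B : Finset α} (hA : A ⊆ Y) (hAe : #A = e) (hB : B ⊆ Y) (hBe : #B = e) (h : p A) : p B := by
  induction hn : #(B \ A) generalizing A with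
  | zero =>
    have : B ⊆ A := by rwa [card_eq_zero, sdiff_eq_empty_iff_subset] at hn
    rwa [eq_of_subset_of_card_le this (by omega)]
  | succ n ih =>
    obtain ⟨b, hb⟩ := card_pos.1 (by omega : 0 < #(B \ A))
    have : #(A \ B) = #(B \ A) := by
      have h1 := card_sdiff_add_card_inter A B
      have h2 := card_sdiff_add_card_inter B A
      rw [inter_comm B A] at h2
      omega
    obtain ⟨a, ha⟩ := card_pos.1 (by omega : 0 < #(A \ B))
    rw [mem_sdiff] at ha hb
    refine ih (swapSet_subset (hA ha.1) (hB hb.1) hA) (by rw [card_swapSet, hAe])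
      (hp A hA hAe h a ha.1 b (hB hb.1) hb.2) ?_
    rw [swapSet_of_mem ha.1 hb.2]
    have : B \ insert b (A.erase a) = (B \ A).erase b := by
      ext x
      simp only [mem_sdiff, mem_insert, mem_erase]
      by_cases hx : x = a
      · subst hx; simp [ha.2]
      · simp [hx]; tauto
    rw [this, card_erase_of_mem (mem_sdiff.2 hb), hn]
    rfl

theorem upIn_inter_nonempty_of_swapSet {P Q : Finset (Finset α)} {D : Finset α} (ha : a ∈ Y)
    (hb : b ∈ Y) (hQ : D ∈ Q) (hP : swapSet a b D ∈ P) (hne : swapSet a b D ≠ D) :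
    (upIn Y P ∩ upIn Y Q).Nonempty := by
  wlog hab : a ∈ D ∧ b ∉ D generalizing a b
  · refine this hb ha (swapSet_comm D ▸ hP) (swapSet_comm D ▸ hne) ?_
    by_contra h
    exact hne (swapSet_of_iff (by tauto))
  refine ⟨insert b D, mem_inter.2 ⟨mem_upIn_iff_erase.2 ⟨a, mem_insert_of_mem hab.1, ha, ?_⟩,
    mem_upIn.2 ⟨D, hQ, b, hb, hab.2, rfl⟩⟩⟩
  rw [swapSet_of_mem hab.1 hab.2] at hP
  rwa [erase_insert_of_ne]
  rintro rfl
  exact hab.2 hab.1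

end Swap

section Pairs

variable {Y : Finset α} {e : ℕ} {P Q : Finset (Finset α)}

/-- A pair of families with least sum of upper shadows for its total size. -/
def PairMin (Y : Finset α) (e : ℕ) (P Q : Finset (Finset α)) : Prop :=
  P ⊆ powersetCard e Y ∧ Q ⊆ powersetCard e Y ∧
    ∀ P' ⊆ powersetCard e Y, ∀ Q' ⊆ powersetCard e Y, #P' + #Q' = #P + #Q →
      #(upIn Y P) + #(upIn Y Q) ≤ #(upIn Y P') + #(upIn Y Q')

theorem PairMin.symm (h : PairMin Y e P Q) : PairMin Y e Q P :=
  ⟨h.2.1, h.1, fun P' hP' Q' hQ' hc => by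
    have := h.2.2 P' hP' Q' hQ' (by omega)
    omega⟩

theorem PairMin.swapFam {a b : α} (h : PairMin Y e P Q) (ha : a ∈ Y) (hb : b ∈ Y) :
    PairMin Y e P (swapFam a b Q) :=
  ⟨h.1, swapFam_subset ha hb h.2.1, fun P' hP' Q' hQ' hc => by
    rw [card_swapFam] at hc
    rw [upIn_swapFam ha hb, card_swapFam]
    exact h.2.2 P' hP' Q' hQ' hc⟩

theorem PairMin.uncross (h : PairMin Y e P Q) :
    PairMin Y e (P ∪ Q) (P ∩ Q) ∧ upIn Y (P ∩ Q) = upIn Y P ∩ upIn Y Q := by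
  have h1 : P ∪ Q ⊆ powersetCard e Y := union_subset h.1 h.2.1
  have h2 : P ∩ Q ⊆ powersetCard e Y := inter_subset_left.trans h.1
  have h3 := card_union_add_card_inter P Q
  have h4 := card_union_add_card_inter (upIn Y P) (upIn Y Q)
  have h5 : upIn Y (P ∩ Q) ⊆ upIn Y P ∩ upIn Y Q :=
    subset_inter (upIn_mono inter_subset_left) (upIn_mono inter_subset_right)
  have h6 := card_le_card h5
  have h7 := h.2.2 _ h1 _ h2 h3
  rw [upIn_union] at h7
  refine ⟨⟨h1, h2, fun P' hP' Q' hQ' hc => ?_⟩, eq_of_subset_of_card_le h5 (by omega)⟩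
  have := h.2.2 P' hP' Q' hQ' (by omega)
  rw [upIn_union]
  omega

theorem PairMin.inter_nonempty (h : PairMin Y e P Q) (hP : P.Nonempty) (hQ : Q.Nonempty) :
    (P ∩ Q).Nonempty := by
  by_contra hne
  rw [not_nonempty_iff_eq_empty] at hne
  obtain ⟨A, hA⟩ := hP
  obtain ⟨B, hB⟩ := hQ
  obtain ⟨hA1, hA2⟩ := mem_powersetCard.1 (h.1 hA)
  obtain ⟨hB1, hB2⟩ := mem_powersetCard.1 (h.2.1 hB)
  have hstep : ∀ B ⊆ Y, #B = e → (∃ Q', PairMin Y e P Q' ∧ P ∩ Q' = ∅ ∧ B ∈ Q') →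
      ∀ a ∈ B, ∀ b ∈ Y, b ∉ B → ∃ Q', PairMin Y e P Q' ∧ P ∩ Q' = ∅ ∧ swapSet a b B ∈ Q' := by
    rintro B hBY - ⟨Q', hmin, hdisj, hBQ⟩ a ha b hb -
    refine ⟨_, hmin.swapFam (hBY ha) hb, ?_, by rwa [mem_swapFam, swapSet_swapSet]⟩
    rw [eq_empty_iff_forall_notMem]
    intro C hC
    rw [mem_inter, mem_swapFam] at hC
    have hCQ : C ∉ Q' := fun h => notMem_empty C (hdisj ▸ mem_inter.2 ⟨hC.1, h⟩)
    have hne := upIn_inter_nonempty_of_swapSet (P := P) (D := swapSet a b C) (hBY ha) hb hC.2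
      (by rw [swapSet_swapSet]; exact hC.1)
      (by rw [swapSet_swapSet]; intro h; exact hCQ (h ▸ hC.2))
    rw [← hmin.uncross.2, hdisj, upIn_empty] at hne
    exact not_nonempty_empty hne
  obtain ⟨Q', -, hdisj, hAQ⟩ := exchange_connected
    (fun B => ∃ Q', PairMin Y e P Q' ∧ P ∩ Q' = ∅ ∧ B ∈ Q') hstep hB1 hB2 hA1 hA2 ⟨Q, h, hne, hB⟩
  exact notMem_empty A (hdisj ▸ mem_inter.2 ⟨hA, hAQ⟩)

theorem dual_union (d : ℕ) : dual Y d (P ∪ Q) = dual Y d P ∩ dual Y d Q := by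
  ext B; simp only [mem_dual, mem_union, mem_inter]; tauto

theorem dual_inter (d : ℕ) : dual Y d (P ∩ Q) = dual Y d P ∪ dual Y d Q := by
  ext B; simp only [mem_dual, mem_union, mem_inter]; tauto

/-- No pair of proper nonempty families is extremal together with its dual pair. -/
theorem not_pairMin_of_pairMin_dual {c : ℕ} (h : PairMin Y e P Q)
    (h' : PairMin Y c (dual Y e P) (dual Y e Q)) (hP : P.Nonempty) (hQ : Q.Nonempty)
    (hP' : (dual Y e P).Nonempty) (hQ' : (dual Y e Q).Nonempty) : False := by
  induction hq : #Q using Nat.strong_induction_on generalizing P Q with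
  | _ q ih =>
  obtain ⟨B, hB⟩ := hQ
  obtain ⟨C, hC⟩ := hP'
  obtain ⟨-, hC1, hC2⟩ := mem_dual.1 hC
  obtain ⟨hB1, hB2⟩ := mem_powersetCard.1 (h.2.1 hB)
  let p : Finset α → Prop := fun B => ∃ R, PairMin Y e P R ∧
    PairMin Y c (dual Y e P) (dual Y e R) ∧ #R = #Q ∧ (dual Y e R).Nonempty ∧ B ∈ R
  have hstep : ∀ B ⊆ Y, #B = e → p B → ∀ a ∈ B, ∀ b ∈ Y, b ∉ B → p (swapSet a b B) := by
    rintro B hBY - ⟨R, h1, h2, h3, h4, h5⟩ a ha b hb -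
    refine ⟨swapFam a b R, h1.swapFam (hBY ha) hb, ?_, by rw [card_swapFam, h3], ?_,
      by rwa [mem_swapFam, swapSet_swapSet]⟩
    · rw [dual_swapFam (hBY ha) hb]
      exact h2.swapFam (hBY ha) hb
    · rw [dual_swapFam (hBY ha) hb]
      exact h4.image _
  obtain ⟨R, hR, hR', hcR, hneR, hCR⟩ :=
    exchange_connected p hstep hB1 hB2 sdiff_subset hC1 ⟨Q, h, h', rfl, hQ', hB⟩
  have hlt : #(P ∩ R) < q := by
    rw [← hq, ← hcR]
    exact card_lt_card ⟨inter_subset_right, fun hs => hC2 (mem_inter.1 (hs hCR)).1⟩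
  refine ih _ hlt hR.uncross.1 ?_ (hP.mono subset_union_left)
    (hR.inter_nonempty hP ⟨_, hCR⟩) ?_ ?_ rfl
  · rw [dual_union, dual_inter]
    exact hR'.uncross.1.symm
  · rw [dual_union]
    exact hR'.inter_nonempty ⟨_, hC⟩ hneR
  · rw [dual_inter]
    exact hneR.mono subset_union_right

end Pairs

section Reduction

variable {X Y : Finset α} {i j : α}

theorem member_eq_powersetCard {e : ℕ} {V : Finset (Finset α)} (hj : j ∈ Y)
    (hV : V ⊆ powersetCard (e + 1) Y) (hstar : ∀ B ∈ powersetCard (e + 1) Y, j ∈ B → B ∈ V) :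
    memberSubfamily j V = powersetCard e (Y.erase j) := by
  refine (member_subset hV).antisymm fun B hB => ?_
  obtain ⟨h1, h2⟩ := mem_powersetCard.1 hB
  obtain ⟨h3, h4⟩ := subset_erase.1 h1
  refine mem_memberSubfamily.2 ⟨hstar _ (mem_powersetCard.2
    ⟨insert_subset hj h3, by rw [card_insert_of_notMem h4, h2]⟩) (mem_insert_self _ _), h4⟩

theorem upIn_powersetCard (e : ℕ) : upIn Y (powersetCard e Y) = powersetCard (e + 1) Y := by
  refine (upIn_subset Subset.rfl).antisymm fun B hB => ?_
  obtain ⟨h1, h2⟩ := mem_powersetCard.1 hB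
  obtain ⟨x, hx⟩ := card_pos.1 (by omega : 0 < #B)
  exact mem_upIn_iff_erase.2 ⟨x, hx, h1 hx, mem_powersetCard.2
    ⟨(erase_subset _ _).trans h1, by rw [card_erase_of_mem hx, h2]; rfl⟩⟩

theorem subset_upIn_of_star {e : ℕ} {U V : Finset (Finset α)}
    (hU : U ⊆ powersetCard (e + 2) Y) (hUj : ∀ B ∈ U, j ∈ B)
    (hVj : ∀ B ∈ powersetCard (e + 1) Y, j ∈ B → B ∈ V) : U ⊆ upIn Y V := by
  intro B hB
  obtain ⟨h1, h2⟩ := mem_powersetCard.1 (hU hB)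
  obtain ⟨y, hy, hne⟩ := exists_mem_ne (by omega : 1 < #B) j
  exact mem_upIn_iff_erase.2 ⟨y, hy, h1 hy, hVj _ (mem_powersetCard.2
    ⟨(erase_subset _ _).trans h1, by rw [card_erase_of_mem hy, h2]; rfl⟩)
    (mem_erase.2 ⟨hne.symm, hUj B hB⟩)⟩

theorem card_of_star {e : ℕ} {U V : Finset (Finset α)} (hj : j ∈ Y)
    (hUj : ∀ B ∈ U, j ∈ B) (hV : V ⊆ powersetCard (e + 1) Y)
    (hVj : ∀ B ∈ powersetCard (e + 1) Y, j ∈ B → B ∈ V) :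
    #U = #(memberSubfamily j U) ∧
    #(upIn Y U) = #(upIn (Y.erase j) (memberSubfamily j U)) ∧
    #V = #(powersetCard e (Y.erase j)) + #(nonMemberSubfamily j V) ∧
    #(upIn Y V) = #(powersetCard (e + 1) (Y.erase j)) +
      #(upIn (Y.erase j) (nonMemberSubfamily j V)) := by
  have hU0 : nonMemberSubfamily j U = ∅ := by
    rw [eq_empty_iff_forall_notMem]
    intro B hB
    rw [mem_nonMemberSubfamily] at hB
    exact hB.2 (hUj B hB.1)
  refine ⟨?_, ?_, ?_, ?_⟩
  · rw [← card_memberSubfamily_add_card_nonMemberSubfamily j U, hU0, card_empty, add_zero]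
  · rw [card_upIn hj, hU0, upIn_empty, empty_union, card_empty, add_zero]
  · rw [← card_memberSubfamily_add_card_nonMemberSubfamily j V, member_eq_powersetCard hj hV hVj]
  · rw [card_upIn hj, member_eq_powersetCard hj hV hVj, upIn_powersetCard,
      union_eq_right.2 (nonMember_subset hV)]

/-- A Gotzmann family whose sections have the sizes of a family inside a star and of a family
containing that star yields an extremal pair. -/
theorem IsGotz.pairMin {e : ℕ} {𝒜 U V : Finset (Finset α)} (h : IsGotz X (e + 2) 𝒜)
    (hi : i ∈ X) (hj : j ∈ X.erase i)
    (hNM : nonMemberSubfamily i 𝒜 ⊆ upIn (X.erase i) (memberSubfamily i 𝒜))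
    (hU : U ⊆ powersetCard (e + 2) (X.erase i)) (hV : V ⊆ powersetCard (e + 1) (X.erase i))
    (hUj : ∀ B ∈ U, j ∈ B) (hVj : ∀ B ∈ powersetCard (e + 1) (X.erase i), j ∈ B → B ∈ V)
    (cU : #U = #(nonMemberSubfamily i 𝒜)) (cV : #V = #(memberSubfamily i 𝒜))
    (uU : #(upIn (X.erase i) U) = #(upIn (X.erase i) (nonMemberSubfamily i 𝒜)))
    (uV : #(upIn (X.erase i) V) = #(upIn (X.erase i) (memberSubfamily i 𝒜))) :
    PairMin ((X.erase i).erase j) (e + 1) (nonMemberSubfamily j V) (memberSubfamily j U) := by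
  refine ⟨nonMember_subset hV, member_subset hU, fun P hP Q hQ hc => ?_⟩
  obtain ⟨c1, c2, c3, c4⟩ := card_of_star hj hUj hV hVj
  have hfull : powersetCard e ((X.erase i).erase j) ⊆ powersetCard e ((X.erase i).erase j) :=
    Subset.rfl
  have hE : (∅ : Finset (Finset α)) ⊆ powersetCard (e + 2) ((X.erase i).erase j) :=
    empty_subset _
  set U' := glue j ∅ Q with hU'
  set V' := glue j P (powersetCard e ((X.erase i).erase j)) with hV'
  have sU : U' ⊆ powersetCard (e + 2) (X.erase i) := glue_subset hj hE hQ
  have sV : V' ⊆ powersetCard (e + 1) (X.erase i) := glue_subset hj hP hfull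
  have hUj' : ∀ B ∈ U', j ∈ B := by
    intro B hB
    rw [hU', glue, empty_union, mem_image] at hB
    obtain ⟨A, -, rfl⟩ := hB
    exact mem_insert_self _ _
  have hVj' : ∀ B ∈ powersetCard (e + 1) (X.erase i), j ∈ B → B ∈ V' := by
    intro B hB hjB
    obtain ⟨h1, h2⟩ := mem_powersetCard.1 hB
    rw [hV', glue, mem_union, mem_image]
    exact Or.inr ⟨B.erase j, mem_powersetCard.2 ⟨erase_subset_erase _ h1,
      by rw [card_erase_of_mem hjB, h2]; rfl⟩, insert_erase hjB⟩
  obtain ⟨d1, d2, d3, d4⟩ := card_of_star hj hUj' sV hVj'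
  rw [hU', member_glue hE hQ, ← hU'] at d1 d2
  rw [hV', nonMember_glue hP, ← hV'] at d3 d4
  have key := h.2 _ (glue_subset hi sU sV) (by
    rw [card_glue sU sV, ← card_memberSubfamily_add_card_nonMemberSubfamily i 𝒜]
    omega)
  rw [card_upIn_glue hi sU sV, card_upIn hi, union_eq_right.2 hNM,
    union_eq_right.2 (subset_upIn_of_star sU hUj' hVj')] at key
  omega

theorem card_memberSubfamily (i : α) (𝒜 : Finset (Finset α)) :
    #(memberSubfamily i 𝒜) = #(𝒜.filter fun A => i ∈ A) := by
  have h1 := card_memberSubfamily_add_card_nonMemberSubfamily i 𝒜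
  have h2 := card_filter_add_card_filter_not (s := 𝒜) (fun A => i ∈ A)
  rw [nonMemberSubfamily] at h1
  omega

/-- If every member containing `i` contains `j`, of no greater degree, then every member
contains `i`. -/
theorem nonMember_eq_empty_of_star {𝒜 : Finset (Finset α)}
    (hNM : nonMemberSubfamily i 𝒜 ⊆ upIn (X.erase i) (memberSubfamily i 𝒜))
    (hmax : #(memberSubfamily j 𝒜) ≤ #(memberSubfamily i 𝒜))
    (hj : ∀ A ∈ memberSubfamily i 𝒜, j ∈ A) : nonMemberSubfamily i 𝒜 = ∅ := by
  have hsub : (𝒜.filter fun A => i ∈ A) ⊆ 𝒜.filter fun A => j ∈ A := by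
    intro A hA
    obtain ⟨h1, h2⟩ := mem_filter.1 hA
    refine mem_filter.2 ⟨h1, mem_of_mem_erase (hj (A.erase i) ?_)⟩
    rw [mem_memberSubfamily, insert_erase h2]
    exact ⟨h1, notMem_erase _ _⟩
  have heq := eq_of_subset_of_card_le hsub (by rwa [← card_memberSubfamily, ← card_memberSubfamily])
  rw [eq_empty_iff_forall_notMem]
  intro B hB
  obtain ⟨A, hA, x, -, -, rfl⟩ := mem_upIn.1 (hNM hB)
  obtain ⟨h1, h2⟩ := mem_nonMemberSubfamily.1 hB
  have : insert x A ∈ 𝒜.filter fun A => j ∈ A :=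
    mem_filter.2 ⟨h1, mem_insert_of_mem (hj A hA)⟩
  rw [← heq] at this
  exact h2 (mem_filter.1 this).2

theorem swapSet_conj {a b : α} (B : Finset α) (hab : a ≠ b) (hib : b ≠ i) :
    swapSet i a (swapSet i b (swapSet i a B)) = swapSet a b B := by
  ext x
  simp only [mem_swapSet, Equiv.swap_apply_def]
  grind

/-- A section at an element of greatest degree in a proper nonempty family has an upper shadow
leaving the other section. -/
theorem not_upIn_subset_of_max {d : ℕ} {𝒜 : Finset (Finset α)} (h : 𝒜 ⊆ powersetCard d X)
    (hi : i ∈ X) (hmax : ∀ k ∈ X, #(memberSubfamily k 𝒜) ≤ #(memberSubfamily i 𝒜))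
    (hne : 𝒜.Nonempty) {C : Finset α} (hC : C ∈ powersetCard d X) (hCA : C ∉ 𝒜) :
    ¬ upIn (X.erase i) (memberSubfamily i 𝒜) ⊆ nonMemberSubfamily i 𝒜 := by
  intro hbad
  have h1 : ∀ j ∈ X, ∀ A ∈ 𝒜, i ∈ A → swapSet i j A ∈ 𝒜 := by
    intro j hj A hA hiA
    by_cases hjA : j ∈ A
    · rwa [swapSet_of_iff (by tauto)]
    · rw [swapSet_of_mem hiA hjA]
      refine (mem_nonMemberSubfamily.1 (hbad (mem_upIn.2 ⟨A.erase i, ?_, j, ?_, ?_, rfl⟩))).1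
      · rw [mem_memberSubfamily, insert_erase hiA]
        exact ⟨hA, notMem_erase _ _⟩
      · exact mem_erase.2 ⟨fun e => hjA (e ▸ hiA), hj⟩
      · exact fun h => hjA (mem_of_mem_erase h)
  have h2 : ∀ j ∈ X, swapFam i j (memberSubfamily i 𝒜) = memberSubfamily j 𝒜 := by
    intro j hj
    refine eq_of_subset_of_card_le (fun B hB => ?_) (by rw [card_swapFam]; exact hmax j hj)
    rw [mem_swapFam, mem_memberSubfamily] at hB
    have h3 := h1 j hj _ hB.1 (mem_insert_self _ _)
    rw [swapSet_insert, swapSet_swapSet, Equiv.swap_apply_left] at h3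
    refine mem_memberSubfamily.2 ⟨h3, fun h => hB.2 ?_⟩
    rwa [mem_swapSet, Equiv.swap_apply_left]
  have h3 : ∀ j ∈ X, ∀ A ∈ 𝒜, swapSet i j A ∈ 𝒜 := by
    intro j hj A hA
    by_cases hiA : i ∈ A
    · exact h1 j hj A hA hiA
    by_cases hjA : j ∈ A
    · have : A.erase j ∈ memberSubfamily j 𝒜 := by
        rw [mem_memberSubfamily, insert_erase hjA]
        exact ⟨hA, notMem_erase _ _⟩
      rw [← h2 j hj, mem_swapFam, mem_memberSubfamily] at this
      have h4 := this.1
      rwa [show insert i (swapSet i j (A.erase j)) = swapSet i j A by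
        conv_rhs => rw [← insert_erase hjA, swapSet_insert, Equiv.swap_apply_right]] at h4
    · rwa [swapSet_of_iff (by tauto)]
  obtain ⟨A, hA⟩ := hne
  obtain ⟨hA1, hA2⟩ := mem_powersetCard.1 (h hA)
  obtain ⟨hC1, hC2⟩ := mem_powersetCard.1 hC
  refine hCA (exchange_connected (Y := X) (fun B => B ∈ 𝒜) ?_ hA1 hA2 hC1 hC2 hA)
  rintro B hBX - hB a ha b hb hbB
  have hab : a ≠ b := fun e => hbB (e ▸ ha)
  by_cases hib : b = i
  · subst hib
    rw [swapSet_comm]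
    exact h3 a (hBX ha) B hB
  · rw [← swapSet_conj (i := i) B hab hib]
    exact h3 _ (hBX ha) _ (h3 _ hb _ (h3 _ (hBX ha) _ hB))

theorem not_upIn_dual_subset {d : ℕ} {𝒜 : Finset (Finset α)} (h : 𝒜 ⊆ powersetCard (d + 1) X)
    (hi : i ∈ X) (hbad : ¬ upIn (X.erase i) (memberSubfamily i 𝒜) ⊆ nonMemberSubfamily i 𝒜) :
    ¬ upIn (X.erase i) (memberSubfamily i (dual X (d + 1) 𝒜)) ⊆
      nonMemberSubfamily i (dual X (d + 1) 𝒜) := by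
  intro hs
  apply hbad
  intro B hB
  have hBc := mem_powersetCard.1 (upIn_subset (member_subset h) hB)
  obtain ⟨A, hA, x, hx, hxA, rfl⟩ := mem_upIn.1 hB
  have hAc := mem_powersetCard.1 (member_subset h hA)
  rw [mem_nonMemberSubfamily]
  have hi' : i ∉ insert x A := (subset_erase.1 hBc.1).2
  refine ⟨?_, hi'⟩
  by_contra hBA
  have h1 : X.erase i \ insert x A ∈ memberSubfamily i (dual X (d + 1) 𝒜) := by
    rw [member_dual hi, sdiff_mem_dual hBc.1 hBc.2, mem_nonMemberSubfamily]
    exact fun h => hBA h.1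
  have h2 : X.erase i \ A ∈ nonMemberSubfamily i (dual X (d + 1) 𝒜) := by
    apply hs
    refine mem_upIn.2 ⟨_, h1, x, hx, by simp, ?_⟩
    ext y
    by_cases hy : y = x
    · subst hy; simp [hxA, (mem_erase.1 hx)]
    · simp [hy]
  rw [nonMember_dual hi, sdiff_mem_dual hAc.1 hAc.2] at h2
  exact h2 hA

end Reduction

section Main

variable {X : Finset α} {i : α}

theorem exists_succ_of_nonempty {d c : ℕ} {𝒜 : Finset (Finset α)} (h : 𝒜 ⊆ powersetCard d X)
    (hc : d + c = #X) (hne : 𝒜.Nonempty) (hne' : (dual X d 𝒜).Nonempty) :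
    (∃ e, d = e + 1) ∧ ∃ f, c = f + 1 := by
  obtain ⟨A, hA⟩ := hne
  obtain ⟨B, hB⟩ := hne'
  obtain ⟨hA1, hA2⟩ := mem_powersetCard.1 (h hA)
  obtain ⟨hB1, hB2, hB3⟩ := mem_dual.1 hB
  constructor
  · refine Nat.exists_eq_succ_of_ne_zero ?_
    rintro rfl
    rw [card_eq_zero] at hA2 hB2
    exact hB3 (by rwa [hB2, ← hA2])
  · refine Nat.exists_eq_succ_of_ne_zero ?_
    rintro rfl
    apply hB3
    rwa [eq_of_subset_of_card_le (sdiff_subset (s := X) (t := B)) (by omega),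
      ← eq_of_subset_of_card_le hA1 (by omega)]

theorem card_member_dual_le {d : ℕ} {𝒜 : Finset (Finset α)} {k : α}
    (h : 𝒜 ⊆ powersetCard d X) (hi : i ∈ X) (hk : k ∈ X)
    (hmax : #(memberSubfamily k 𝒜) ≤ #(memberSubfamily i 𝒜)) :
    #(memberSubfamily k (dual X d 𝒜)) ≤ #(memberSubfamily i (dual X d 𝒜)) := by
  rw [member_dual hi, member_dual hk]
  have h1 := card_dual_add (nonMember_subset (i := i) h)
  have h2 := card_dual_add (nonMember_subset (i := k) h)
  rw [card_erase_of_mem hi] at h1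
  rw [card_erase_of_mem hk] at h2
  have h3 := card_memberSubfamily_add_card_nonMemberSubfamily i 𝒜
  have h4 := card_memberSubfamily_add_card_nonMemberSubfamily k 𝒜
  omega

/-- A family that is Gotzmann together with its dual is contained in a star, or its dual is. -/
theorem exists_star {d c : ℕ} {𝒜 : Finset (Finset α)} (hX : X.Nonempty) (hc : d + c = #X)
    (h : IsGotz X d 𝒜) (h' : IsGotz X c (dual X d 𝒜)) :
    ∃ i ∈ X, (∀ A ∈ 𝒜, i ∈ A) ∨ ∀ B ∈ dual X d 𝒜, i ∈ B := by
  induction hn : #X generalizing X d c 𝒜 with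
  | zero => exact absurd hX (by rw [card_eq_zero.1 hn]; simp)
  | succ n ih =>
  rcases 𝒜.eq_empty_or_nonempty with rfl | hne
  · obtain ⟨i, hi⟩ := hX
    exact ⟨i, hi, Or.inl (by simp)⟩
  rcases (dual X d 𝒜).eq_empty_or_nonempty with hE | hne'
  · obtain ⟨i, hi⟩ := hX
    exact ⟨i, hi, Or.inr (by simp [hE])⟩
  obtain ⟨⟨e, rfl⟩, f, rfl⟩ := exists_succ_of_nonempty h.1 hc hne hne'
  obtain ⟨i, hi, hmax⟩ := exists_max_image X (fun k => #(memberSubfamily k 𝒜)) hX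
  have hcY : #(X.erase i) + 1 = #X := card_erase_add_one hi
  obtain ⟨C, hC⟩ := hne'
  obtain ⟨-, hC1, hC2⟩ := mem_dual.1 hC
  have hgood := not_upIn_subset_of_max h.1 hi hmax hne
    (mem_powersetCard.2 ⟨sdiff_subset, hC1⟩) hC2
  have hgood' := not_upIn_dual_subset h.1 hi hgood
  obtain ⟨gN, hs⟩ := h.sections hi (by omega)
  obtain ⟨gM, hNM⟩ := hs hgood
  obtain ⟨gN', hs'⟩ := h'.sections hi (by omega)
  obtain ⟨gM', hNM'⟩ := hs' hgood'
  by_cases hN0 : nonMemberSubfamily i 𝒜 = ∅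
  · refine ⟨i, hi, Or.inl fun A hA => ?_⟩
    by_contra hiA
    exact notMem_empty A (hN0 ▸ mem_nonMemberSubfamily.2 ⟨hA, hiA⟩)
  by_cases hM0 : nonMemberSubfamily i (dual X (e + 1) 𝒜) = ∅
  · refine ⟨i, hi, Or.inr fun A hA => ?_⟩
    by_contra hiA
    exact notMem_empty A (hM0 ▸ mem_nonMemberSubfamily.2 ⟨hA, hiA⟩)
  exfalso
  have hjM : ∀ j ∈ X, ¬ ∀ A ∈ memberSubfamily i 𝒜, j ∈ A := fun j hj hall =>
    hN0 (nonMember_eq_empty_of_star hNM (hmax j hj) hall)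
  have hkN : ∀ k ∈ X, ¬ ∀ A ∈ memberSubfamily i (dual X (e + 1) 𝒜), k ∈ A := fun k hk hall =>
    hM0 (nonMember_eq_empty_of_star hNM' (card_member_dual_le h.1 hi hk (hmax k hk)) hall)
  have eN' := nonMember_dual hi e 𝒜
  have eM' := member_dual hi (e + 1) 𝒜
  rw [eN'] at gN' hM0
  rw [eM'] at gM' hkN
  have hYne : (X.erase i).Nonempty := card_pos.1 (by omega)
  obtain ⟨j, hj, hjs⟩ := ih hYne (by omega) gM gN' (by omega)
  obtain ⟨k, hk, hks⟩ := ih hYne (by omega) gN gM' (by omega)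
  have hMj := hjM j (mem_of_mem_erase hj)
  have hNk := hkN k (mem_of_mem_erase hk)
  replace hjs := hjs.resolve_left hMj
  replace hks := hks.resolve_right hNk
  set Y := X.erase i
  set N := nonMemberSubfamily i 𝒜 with hN
  set M := memberSubfamily i 𝒜 with hM
  push Not at hMj hNk
  obtain ⟨A₁, hA₁, hjA₁⟩ := hMj
  obtain ⟨B₁, hB₁, hkB₁⟩ := hNk
  obtain ⟨A₀, hA₀⟩ := nonempty_iff_ne_empty.2 hN0
  obtain ⟨B₀, hB₀⟩ := nonempty_iff_ne_empty.2 hM0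
  obtain ⟨⟨e, rfl⟩, -⟩ := exists_succ_of_nonempty gM.1 (c := f + 1) (by omega) ⟨_, hA₁⟩ ⟨_, hB₀⟩
  obtain ⟨-, f, rfl⟩ := exists_succ_of_nonempty gN.1 (c := f) (by omega) ⟨_, hA₀⟩ ⟨_, hB₁⟩
  have sU := swapFam_subset hj hk gN.1
  have hUj : ∀ B ∈ swapFam j k N, j ∈ B := by
    intro B hB
    have := hks _ (mem_swapFam.1 hB)
    rwa [mem_swapSet, Equiv.swap_apply_right] at this
  have hVj : ∀ B ∈ powersetCard (e + 1) Y, j ∈ B → B ∈ M := by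
    intro B hB hjB
    obtain ⟨h1, h2⟩ := mem_powersetCard.1 hB
    by_contra hBM
    exact (mem_sdiff.1 (hjs _ ((sdiff_mem_dual h1 h2).2 hBM))).2 hjB
  have hVj' : ∀ B ∈ powersetCard (f + 1) Y, j ∈ B → B ∈ dual Y (e + 1 + 1) (swapFam j k N) := by
    intro B hB hjB
    obtain ⟨h1, h2⟩ := mem_powersetCard.1 hB
    have := card_sdiff_add_card_eq_card h1
    exact mem_dual.2 ⟨h1, by omega, fun h => (mem_sdiff.1 (hUj _ h)).2 hjB⟩
  have p1 := h.pairMin hi hj hNM sU gM.1 hUj hVj (card_swapFam _) rfl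
    (by rw [upIn_swapFam hj hk, card_swapFam]) rfl
  have p2 := h'.pairMin (U := dual Y (e + 1) M) (V := dual Y (e + 1 + 1) (swapFam j k N)) hi hj
    hNM' gN'.1 (by rw [dual_swapFam hj hk]; exact swapFam_subset hj hk gM'.1) hjs hVj'
    (by rw [eN']) (by rw [eM', dual_swapFam hj hk, card_swapFam]) (by rw [eN'])
    (by rw [eM', dual_swapFam hj hk, upIn_swapFam hj hk, card_swapFam])
  rw [nonMember_dual hj, member_dual hj] at p2
  refine not_pairMin_of_pairMin_dual p1 p2.symm ⟨A₁, mem_nonMemberSubfamily.2 ⟨hA₁, hjA₁⟩⟩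
    ?_ ?_ ?_
  · have hm : swapSet j k A₀ ∈ swapFam j k N := by rwa [mem_swapFam, swapSet_swapSet]
    refine ⟨(swapSet j k A₀).erase j, mem_memberSubfamily.2 ⟨?_, notMem_erase _ _⟩⟩
    rwa [insert_erase (hUj _ hm)]
  · rw [← member_dual hj]
    refine ⟨B₀.erase j, mem_memberSubfamily.2 ⟨?_, notMem_erase _ _⟩⟩
    rwa [insert_erase (hjs _ hB₀)]
  · rw [← nonMember_dual hj, dual_swapFam hj hk]
    refine ⟨swapSet j k B₁, mem_nonMemberSubfamily.2 ⟨?_, ?_⟩⟩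
    · rwa [mem_swapFam, swapSet_swapSet]
    · rwa [mem_swapSet, Equiv.swap_apply_left]

theorem IsGotz.memberSubfamily_of_star {d : ℕ} {𝒜 : Finset (Finset α)} (h : IsGotz X (d + 1) 𝒜)
    (hi : i ∈ X) (hd : d + 2 ≤ #X) (hall : ∀ A ∈ 𝒜, i ∈ A) :
    IsGotz (X.erase i) d (memberSubfamily i 𝒜) := by
  by_cases hbad : upIn (X.erase i) (memberSubfamily i 𝒜) ⊆ nonMemberSubfamily i 𝒜
  · refine ⟨member_subset h.1, fun ℬ _ _ => ?_⟩
    have : upIn (X.erase i) (memberSubfamily i 𝒜) = ∅ := by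
      rw [eq_empty_iff_forall_notMem]
      intro B hB
      have := mem_nonMemberSubfamily.1 (hbad hB)
      exact this.2 (hall B this.1)
    simp [this]
  · exact ((h.sections hi hd).2 hbad).1

/-- The relation `r` modified so that `i` comes first. -/
def orderWithFirst (i : α) (r : α → α → Prop) (a b : α) : Prop := b ≠ i ∧ (a = i ∨ r a b)

theorem isLinearOrderOn_orderWithFirst {r : α → α → Prop}
    (h : IsLinearOrderOn r (X.erase i)) : IsLinearOrderOn (orderWithFirst i r) X := by
  obtain ⟨h1, h2, h3⟩ := h
  simp only [mem_erase] at h1 h2 h3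
  refine ⟨?_, ?_, ?_⟩
  · rintro a ha ⟨hne, h⟩
    exact h1 a ⟨hne, ha⟩ (h.resolve_left hne)
  · rintro a ha b hb c hc ⟨hbi, hab⟩ ⟨hci, hbc⟩
    refine ⟨hci, ?_⟩
    by_cases hai : a = i
    · exact Or.inl hai
    · exact Or.inr (h2 a ⟨hai, ha⟩ b ⟨hbi, hb⟩ c ⟨hci, hc⟩ (hab.resolve_left hai)
        (hbc.resolve_left hbi))
  · intro a ha b hb hab
    by_cases hai : a = i
    · exact Or.inl ⟨fun h => hab (hai.trans h.symm), Or.inl hai⟩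
    by_cases hbi : b = i
    · exact Or.inr ⟨hai, Or.inl hbi⟩
    exact (h3 a ⟨hai, ha⟩ b ⟨hbi, hb⟩ hab).imp (fun h => ⟨hbi, Or.inr h⟩)
      fun h => ⟨hai, Or.inr h⟩

theorem lexLT_erase_of_orderWithFirst {r : α → α → Prop} {A B : Finset α}
    (h : lexLT (orderWithFirst i r) A B) (hAB : i ∈ A → i ∈ B) :
    (i ∈ B → i ∈ A) ∧ lexLT r (A.erase i) (B.erase i) := by
  obtain ⟨x, hxA, hxB, hx⟩ := h
  have hxi : x ≠ i := by
    rintro rfl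
    exact hxB (hAB hxA)
  refine ⟨(hx i ⟨hxi, Or.inl rfl⟩).2, x, mem_erase.2 ⟨hxi, hxA⟩,
    fun h => hxB (mem_of_mem_erase h), fun y hy => ?_⟩
  rw [mem_erase, mem_erase, hx y ⟨hxi, Or.inr hy⟩]

theorem exists_isLinearOrderOn {β : Type*} (X : Finset β) :
    ∃ r : β → β → Prop, IsLinearOrderOn r X :=
  ⟨WellOrderingRel, fun a _ => irrefl a, fun _ _ _ _ _ _ => _root_.trans,
    fun a _ b _ hab => by
      rcases trichotomous_of WellOrderingRel a b with h | h | h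
      exacts [Or.inl h, absurd h hab, Or.inr h]⟩

theorem exists_lex_order {d c : ℕ} {𝒜 : Finset (Finset α)} (hc : d + c = #X)
    (h : IsGotz X d 𝒜) (h' : IsGotz X c (dual X d 𝒜)) :
    ∃ r : α → α → Prop, IsLinearOrderOn r X ∧
      ∀ B ∈ 𝒜, ∀ A ⊆ X, #A = d → lexLT r A B → A ∈ 𝒜 := by
  induction hn : #X generalizing X d c 𝒜 with
  | zero =>
    obtain ⟨r, hr⟩ := exists_isLinearOrderOn X
    refine ⟨r, hr, fun B _ A hA _ ⟨x, hx, _⟩ => ?_⟩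
    exact absurd (hA hx) (by rw [card_eq_zero.1 hn]; simp)
  | succ n ih =>
  rcases 𝒜.eq_empty_or_nonempty with rfl | hne
  · obtain ⟨r, hr⟩ := exists_isLinearOrderOn X
    exact ⟨r, hr, by simp⟩
  rcases (dual X d 𝒜).eq_empty_or_nonempty with hE | hne'
  · obtain ⟨r, hr⟩ := exists_isLinearOrderOn X
    refine ⟨r, hr, fun B _ A hA hAd _ => ?_⟩
    by_contra hAn
    exact notMem_empty _ (hE ▸ (sdiff_mem_dual hA hAd).2 hAn)
  obtain ⟨⟨e, rfl⟩, f, rfl⟩ := exists_succ_of_nonempty h.1 hc hne hne'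
  obtain ⟨i, hi, hstar⟩ := exists_star (card_pos.1 (by omega)) hc h h'
  have hcY : #(X.erase i) + 1 = #X := card_erase_add_one hi
  rcases hstar with hstar | hstar
  · have gM := h.memberSubfamily_of_star hi (by omega) hstar
    have gM' := (h'.sections hi (by omega)).1
    rw [nonMember_dual hi] at gM'
    obtain ⟨r, hr, hlex⟩ := ih (by omega) gM gM' (by omega)
    refine ⟨_, isLinearOrderOn_orderWithFirst hr, fun B hB A hA hAd hlt => ?_⟩
    have hiB := hstar B hB
    obtain ⟨hiA, hlt⟩ := lexLT_erase_of_orderWithFirst hlt fun _ => hiB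
    have hm := hlex (B.erase i) (mem_memberSubfamily.2
      ⟨by rwa [insert_erase hiB], notMem_erase _ _⟩) (A.erase i) (erase_subset_erase _ hA)
      (by rw [card_erase_of_mem (hiA hiB), hAd]; rfl) hlt
    rw [mem_memberSubfamily, insert_erase (hiA hiB)] at hm
    exact hm.1
  · have gN := (h.sections hi (by omega)).1
    have gN' := h'.memberSubfamily_of_star hi (by omega) hstar
    rw [member_dual hi] at gN'
    obtain ⟨r, hr, hlex⟩ := ih (by omega) gN gN' (by omega)
    refine ⟨_, isLinearOrderOn_orderWithFirst hr, fun B hB A hA hAd hlt => ?_⟩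
    by_contra hAn
    have hiA : i ∉ A := (mem_sdiff.1 (hstar _ ((sdiff_mem_dual hA hAd).2 hAn))).2
    obtain ⟨hiB, hlt⟩ := lexLT_erase_of_orderWithFirst hlt fun h => absurd h hiA
    replace hiB : i ∉ B := fun h => hiA (hiB h)
    rw [erase_eq_of_notMem hiA, erase_eq_of_notMem hiB] at hlt
    exact hAn (mem_nonMemberSubfamily.1 (hlex B (mem_nonMemberSubfamily.2 ⟨hB, hiB⟩) A
      (subset_erase.2 ⟨hA, hiA⟩) hAd hlt)).1

end Main

section Bridge

variable {X : Finset α} {d : ℕ}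

theorem upShadowIn_coe (X : Finset α) (𝒜 : Finset (Finset α)) :
    upShadowIn X (𝒜 : Set (Finset α)) = upIn X 𝒜 := by
  ext B
  simp only [upShadowIn, Set.mem_ofPred_eq, mem_coe, mem_upIn, eq_comm]

theorem alexDual_coe (X : Finset α) (d : ℕ) (𝒜 : Finset (Finset α)) :
    alexDual X d (𝒜 : Set (Finset α)) = dual X d 𝒜 := by
  ext B
  simp only [alexDual, Set.mem_ofPred_eq, mem_coe]
  constructor
  · rintro ⟨A, h1, h2, h3, rfl⟩
    exact (sdiff_mem_dual h1 h2).2 h3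
  · intro hB
    obtain ⟨h1, h2, h3⟩ := mem_dual.1 hB
    exact ⟨_, sdiff_subset, h2, h3, (Finset.sdiff_sdiff_eq_self h1).symm⟩

theorem isGotz_of_isGotzmannFamily {𝒜 : Finset (Finset α)}
    (h : IsGotzmannFamily X d (𝒜 : Set (Finset α))) : IsGotz X d 𝒜 := by
  refine ⟨fun A hA => mem_powersetCard.2 (h.1 A hA), fun ℬ hB hc => ?_⟩
  have := h.2 ℬ (fun B hB' => mem_powersetCard.1 (hB hB'))
    (by rw [Set.ncard_coe_finset, Set.ncard_coe_finset, hc])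
  rwa [upShadowIn_coe, upShadowIn_coe, Set.ncard_coe_finset, Set.ncard_coe_finset] at this

end Bridge

end GotzmannFamily

/-- **Theorem.** If a family `𝒜` of `d`-element subsets of a finite set `X` is both
Gotzmann and dual-Gotzmann, then `𝒜` is a lex segment for some linear order on `X`. -/
theorem gotzmann_and_dual_gotzmann_is_lex {α : Type*} [DecidableEq α]
    (X : Finset α) (d : ℕ) (𝒜 : Set (Finset α))
    (hG : IsGotzmannFamily X d 𝒜) (hdG : IsDualGotzmann X d 𝒜) :
    ∃ r : α → α → Prop, IsLinearOrderOn r X ∧ IsLexSegmentFamily r X d 𝒜 := by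
  have hfin : 𝒜.Finite := (Finset.powersetCard d X).finite_toSet.subset fun A hA =>
    Finset.mem_coe.2 (Finset.mem_powersetCard.2 (hG.1 A hA))
  lift 𝒜 to Finset (Finset α) using hfin
  by_cases hd : d ≤ X.card
  · rw [IsDualGotzmann, GotzmannFamily.alexDual_coe] at hdG
    obtain ⟨r, hr, hlex⟩ := GotzmannFamily.exists_lex_order (Nat.add_sub_of_le hd)
      (GotzmannFamily.isGotz_of_isGotzmannFamily hG)
      (GotzmannFamily.isGotz_of_isGotzmannFamily hdG)
    exact ⟨r, hr, hG.1, hlex⟩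
  · obtain ⟨r, hr⟩ := GotzmannFamily.exists_isLinearOrderOn X
    refine ⟨r, hr, hG.1, fun B _ A hA hAd _ => absurd (Finset.card_le_card hA) (by omega)⟩
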